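/- (Main lemma) Let C be a based complex of R-modules with a Morse matching M. Define the complex C^M on the graded module ⊕_{α ∈ M⁰ ∩ I_n} C_α with differential d_{C^M}(x) = Σ_{β ∈ M⁰ ∩ I_{n−1}} Γ_{β,α}(x) for x ∈ C_α, α ∈ M⁰ ∩ I_n, and define maps f : C → C^M, g : C^M → C and h : C → C of degree 0, 0 and 1 respectively by f(x) = Σ_{β ∈ M⁰ ∩ I_n} Γ_{β,α}(x), g(x) = Σ_{β ∈ I_n} Γ_{β,α}(x), h(x) = Σ_{β ∈ I_{n+1}} Γ_{β,α}(x) for x ∈ C_α with α ∈ I_n. Then (C^M, C, f, g, h) is a contraction; in particular d_{C^M}² = 0, f and g are chain maps, fg = 1, gf = 1 + dh + hd, fh = 0, hg = 0 and h² = 0. -/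

import Mathlib

noncomputable section
attribute [local instance] Classical.propDecidable

open DirectSum

universe u v w

/-- Directed paths in a digraph on `ι` with edge relation `E`. -/
inductive MPath {ι : Type v} (E : ι → ι → Prop) : ι → ι → Type v
  | nil (α : ι) : MPath E α α
  | cons {α β γ : ι} : E α β → MPath E β γ → MPath E α γ

section Morse

variable (R : Type u) [Ring R] (ι : Type v) [DecidableEq ι]
  (V : ι → Type w) [∀ α, AddCommGroup (V α)] [∀ α, Module R (V α)]

/-- The linear endomorphism of `⨁ α, V α` with components `D α β : V α →ₗ[R] V β`
(by convention `0` on summands whose family of components has infinite support). -/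
def toLin (D : ∀ α β, V α →ₗ[R] V β) : (⨁ α, V α) →ₗ[R] ⨁ α, V α :=
  DirectSum.toModule R ι _ fun α =>
    if h : {β | D α β ≠ 0}.Finite then
      ∑ β ∈ h.toFinset, (DirectSum.lof R ι V β).comp (D α β)
    else 0

/-- `(deg, V, D)` is a based complex: the components `D α β : C_α → C_β` of the
differential lower degree by one, each column is finite, and the total
differential squares to zero. -/
structure IsBasedComplex (deg : ι → ℤ) (D : ∀ α β, V α →ₗ[R] V β) : Prop where
  deg_cond : ∀ α β, deg β ≠ deg α - 1 → D α β = 0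
  fin : ∀ α, {β | D α β ≠ 0}.Finite
  dsq : toLin R ι V D ∘ₗ toLin R ι V D = 0

/-- Edges of the Morse graph `G^M(C)`: edges of `G(C)` not in `M` together with
the reversals of the edges in `M`. -/
def MorseEdge (D : ∀ α β, V α →ₗ[R] V β) (M : Set (ι × ι)) (α β : ι) : Prop :=
  (D α β ≠ 0 ∧ (α, β) ∉ M) ∨ (β, α) ∈ M

/-- `M` is a Morse matching on the based complex `(deg, V, D)`. -/
structure IsMorseMatching (deg : ι → ℤ) (D : ∀ α β, V α →ₗ[R] V β)
    (M : Set (ι × ι)) : Prop where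
  edge : ∀ e ∈ M, D e.1 e.2 ≠ 0
  iso : ∀ e ∈ M, Function.Bijective (D e.1 e.2)
  matching : ∀ e ∈ M, ∀ e' ∈ M,
    e.1 = e'.1 ∨ e.1 = e'.2 ∨ e.2 = e'.1 ∨ e.2 = e'.2 → e = e'
  wf : ∃ r : ι → ι → Prop, WellFounded r ∧ (∀ a b c, r a b → r b c → r a c) ∧
    ∀ α β γ, deg γ = deg α →
      MorseEdge R ι V D M α β → MorseEdge R ι V D M β γ → r γ α

end Morse

/-- The set `M⁰` of vertices not incident to any edge of `M`. -/
def MZero {ι : Type v} (M : Set (ι × ι)) : Set ι := {α | ∀ β, (α, β) ∉ M ∧ (β, α) ∉ M}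

section Morse2

variable (R : Type u) [Ring R] (ι : Type v) [DecidableEq ι]
  (V : ι → Type w) [∀ α, AddCommGroup (V α)] [∀ α, Module R (V α)]

/-- The differential `d̃` of `C̃`, keeping only the components of edges in `M`. -/
def dTilde (D : ∀ α β, V α →ₗ[R] V β) (M : Set (ι × ι)) :
    (⨁ α, V α) →ₗ[R] ⨁ α, V α :=
  toLin R ι V fun α β => if (α, β) ∈ M then D α β else 0

/-- The degree one map `h̃`, sending `x ∈ C_α` to `-d⁻¹_{α,β} x` when `β → α ∈ M`. -/
def hTilde (D : ∀ α β, V α →ₗ[R] V β) (M : Set (ι × ι)) :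
    (⨁ α, V α) →ₗ[R] ⨁ α, V α :=
  DirectSum.toModule R ι _ fun α =>
    if h : ∃ β, (β, α) ∈ M ∧ Function.Bijective (D β α) then
      -((DirectSum.lof R ι V h.choose).comp
        (LinearEquiv.ofBijective (D h.choose α) h.choose_spec.2).symm.toLinearMap)
    else 0

/-- The projection `f̃ : C̃ → C̃^M`. -/
def fTilde (M : Set (ι × ι)) : (⨁ α, V α) →ₗ[R] ⨁ s : MZero M, V s.1 :=
  DirectSum.toModule R ι _ fun α =>
    if h : α ∈ MZero M then
      DirectSum.lof R (MZero M) (fun s => V s.1) ⟨α, h⟩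
    else 0

/-- The inclusion `g̃ : C̃^M → C̃`. -/
def gTilde (M : Set (ι × ι)) : (⨁ s : MZero M, V s.1) →ₗ[R] ⨁ α, V α :=
  DirectSum.toModule R (MZero M) _ fun s => DirectSum.lof R ι V s.1

/-- The map attached to an edge `σ → τ` of the Morse graph: `-d⁻¹_{σ,τ}` if it is
the reversal of an edge of `M`, and the component `d_{τ,σ}` otherwise. -/
def edgeMap (D : ∀ α β, V α →ₗ[R] V β) (M : Set (ι × ι)) (σ τ : ι) :
    V σ →ₗ[R] V τ :=
  if h : (τ, σ) ∈ M ∧ Function.Bijective (D τ σ) then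
    -(LinearEquiv.ofBijective (D τ σ) h.2).symm.toLinearMap
  else D σ τ

/-- The map `C_α → C_β` attached to a directed path in the Morse graph. -/
def pathMap (D : ∀ α β, V α →ₗ[R] V β) (M : Set (ι × ι)) :
    {α β : ι} → MPath (MorseEdge R ι V D M) α β → (V α →ₗ[R] V β)
  | _, _, .nil _ => LinearMap.id
  | _, _, .cons _e p => (pathMap D M p).comp (edgeMap R ι V D M _ _)

/-- `Γ_{β,α} : C_α → C_β`, the sum over all directed paths from `α` to `β` in the
Morse graph of the associated path maps. -/
def Gamma (D : ∀ α β, V α →ₗ[R] V β) (M : Set (ι × ι)) (α β : ι) :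
    V α →ₗ[R] V β :=
  ∑ᶠ p : MPath (MorseEdge R ι V D M) α β, pathMap R ι V D M p

end Morse2
section MorseMaps

variable (R : Type u) [Ring R] (ι : Type v) [DecidableEq ι]
  (V : ι → Type w) [∀ α, AddCommGroup (V α)] [∀ α, Module R (V α)]

/-- The differential of the Morse complex `C^M`. -/
def dMorse (deg : ι → ℤ) (D : ∀ α β, V α →ₗ[R] V β) (M : Set (ι × ι)) :
    (⨁ s : MZero M, V s.1) →ₗ[R] ⨁ s : MZero M, V s.1 :=
  DirectSum.toModule R (MZero M) _ fun s =>
    ∑ᶠ u ∈ {u : MZero M | deg u.1 = deg s.1 - 1},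
      (DirectSum.lof R (MZero M) (fun v : MZero M => V v.1) u).comp
        (Gamma R ι V D M s.1 u.1)

/-- The projection `f : C → C^M` of the main lemma. -/
def fMorse (deg : ι → ℤ) (D : ∀ α β, V α →ₗ[R] V β) (M : Set (ι × ι)) :
    (⨁ α, V α) →ₗ[R] ⨁ s : MZero M, V s.1 :=
  DirectSum.toModule R ι _ fun α =>
    ∑ᶠ u ∈ {u : MZero M | deg u.1 = deg α},
      (DirectSum.lof R (MZero M) (fun v : MZero M => V v.1) u).comp
        (Gamma R ι V D M α u.1)

/-- The inclusion `g : C^M → C` of the main lemma. -/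
def gMorse (deg : ι → ℤ) (D : ∀ α β, V α →ₗ[R] V β) (M : Set (ι × ι)) :
    (⨁ s : MZero M, V s.1) →ₗ[R] ⨁ α, V α :=
  DirectSum.toModule R (MZero M) _ fun s =>
    ∑ᶠ β ∈ {β : ι | deg β = deg s.1},
      (DirectSum.lof R ι V β).comp (Gamma R ι V D M s.1 β)

/-- The homotopy `h : C → C` of the main lemma. -/
def hMorse (deg : ι → ℤ) (D : ∀ α β, V α →ₗ[R] V β) (M : Set (ι × ι)) :
    (⨁ α, V α) →ₗ[R] ⨁ α, V α :=
  DirectSum.toModule R ι _ fun α =>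
    ∑ᶠ β ∈ {β : ι | deg β = deg α + 1},
      (DirectSum.lof R ι V β).comp (Gamma R ι V D M α β)

end MorseMaps

section Perturbation

variable {A : Type*} [Ring A] {d e h S : A}

lemma perturbation_master (hd : d * d = 0) (hde : (d + e) * (d + e) = 0)
    (hl : S * (1 - e * h) = 1) (hr : (1 - e * h) * S = 1) :
    S * e * (1 + d * h + h * d) * (S * e) + S * e * d + d * (S * e) = 0 := by
  set E := S * e * (1 + d * h + h * d) * (S * e) + S * e * d + d * (S * e) with hE
  have hr' : (1 - h * e) * (1 + h * S * e) = 1 := by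
    linear_combination (norm := noncomm_ring) h * hr * e
  have hT : S * e * (1 - h * e) = e := by
    linear_combination (norm := noncomm_ring) hl * e
  have hT' : (1 - e * h) * (S * e) = e := by
    linear_combination (norm := noncomm_ring) hr * e
  have key : (1 - e * h) * E * (1 - h * e) = 0 := by
    have h1 : (1 - e * h) * E * (1 - h * e) =
        ((1 - e * h) * (S * e)) * (1 + d * h + h * d) * (S * e * (1 - h * e)) +
        ((1 - e * h) * (S * e)) * d * (1 - h * e) +
        (1 - e * h) * d * (S * e * (1 - h * e)) := by
      rw [hE]; noncomm_ring
    rw [h1, hT, hT']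
    linear_combination (norm := noncomm_ring) hde - hd
  calc E = (S * (1 - e * h)) * E * ((1 - h * e) * (1 + h * S * e)) := by
        rw [hl, hr', one_mul, mul_one]
    _ = S * ((1 - e * h) * E * (1 - h * e)) * (1 + h * S * e) := by noncomm_ring
    _ = 0 := by rw [key]; simp

lemma perturbation_projection_comm (hd : d * d = 0) (hde : (d + e) * (d + e) = 0)
    (hl : S * (1 - e * h) = 1) (hr : (1 - e * h) * S = 1) :
    S * e * (1 + d * h + h * d) * S = S * (d + e) - d * S := by
  have hm := perturbation_master hd hde hl hr
  have hS : S = 1 + S * e * h := by linear_combination (norm := noncomm_ring) hl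
  have h1 : S * e * (1 + d * h + h * d) * S =
      S * e * (1 + d * h + h * d) * (1 + S * e * h) := by rw [← hS]
  rw [h1]
  linear_combination (norm := noncomm_ring) hm * h - hS * d + d * hS

lemma perturbation_inclusion_comm (hd : d * d = 0) (hde : (d + e) * (d + e) = 0)
    (hl : S * (1 - e * h) = 1) (hr : (1 - e * h) * S = 1) :
    (1 + h * S * e) * (1 + d * h + h * d) * (S * e) =
      (d + e) * (1 + h * S * e) - (1 + h * S * e) * d := by
  have hm := perturbation_master hd hde hl hr
  linear_combination (norm := noncomm_ring) h * hm + hr * e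

lemma perturbation_homotopy (hd : d * d = 0) (hde : (d + e) * (d + e) = 0)
    (hl : S * (1 - e * h) = 1) (hr : (1 - e * h) * S = 1) :
    (1 + h * S * e) * (1 + d * h + h * d) * S =
      1 + (d + e) * (h * S) + h * S * (d + e) := by
  have hp := perturbation_projection_comm hd hde hl hr
  linear_combination (norm := noncomm_ring) h * hp + hr

lemma eq_of_graded_recursion {P₁ P₀ Q₁ Q₂ : A} (hh : h * h = 0) (hr : (1 - e * h) * S = 1)
    (h₁ : P₁ = P₀ * h) (h₀ : P₀ = 1 + P₁ * e + Q₁ * h) (hq : Q₁ = P₀ * e + Q₂ * h) :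
    P₁ = h * S ∧ P₀ = S + h * (S * e * S) := by
  have hP₁ : P₁ = h * S := by
    have : P₁ * (1 - e * h) = h := by
      linear_combination (norm := noncomm_ring) h₁ + h₀ * h + Q₁ * hh
    rw [← mul_one P₁, ← hr, ← mul_assoc, this]
  refine ⟨hP₁, ?_⟩
  have hP₀ : P₀ * (1 - e * h) = 1 + h * S * e := by
    linear_combination (norm := noncomm_ring) h₀ + hP₁ * e + hq * h + Q₂ * hh
  rw [← mul_one P₀, ← hr, ← mul_assoc, hP₀]
  noncomm_ring

end Perturbation

section Contraction

variable {R X Y : Type*} [Ring R] [AddCommGroup X] [Module R X] [AddCommGroup Y] [Module R Y]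

/-- The basic perturbation lemma: a perturbation `e` of the differential `d` of the big complex of
a contraction with zero differential on the small one, with `S` inverse to `1 - e * h`. -/
lemma contraction_of_perturbation {d e h S : Module.End R X} {f : X →ₗ[R] Y} {g : Y →ₗ[R] X}
    (hd : d * d = 0) (hde : (d + e) * (d + e) = 0) (hfd : f ∘ₗ d = 0) (hdg : d ∘ₗ g = 0)
    (hfg : f ∘ₗ g = LinearMap.id) (hgf : g ∘ₗ f = 1 + d * h + h * d)
    (hfh : f ∘ₗ h = 0) (hhg : h ∘ₗ g = 0) (hh : h * h = 0)
    (hl : S * (1 - e * h) = 1) (hr : (1 - e * h) * S = 1) :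
    (f ∘ₗ S ∘ₗ e ∘ₗ g) ∘ₗ (f ∘ₗ S ∘ₗ e ∘ₗ g) = 0 ∧
    (f ∘ₗ S) ∘ₗ (d + e) = (f ∘ₗ S ∘ₗ e ∘ₗ g) ∘ₗ (f ∘ₗ S) ∧
    (d + e) ∘ₗ ((1 + h * S * e) ∘ₗ g) = ((1 + h * S * e) ∘ₗ g) ∘ₗ (f ∘ₗ S ∘ₗ e ∘ₗ g) ∧
    (f ∘ₗ S) ∘ₗ ((1 + h * S * e) ∘ₗ g) = LinearMap.id ∧
    ((1 + h * S * e) ∘ₗ g) ∘ₗ (f ∘ₗ S) =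
      LinearMap.id + (d + e) ∘ₗ (h * S) + (h * S) ∘ₗ (d + e) ∧
    (f ∘ₗ S) ∘ₗ (h * S) = 0 ∧
    (h * S) ∘ₗ ((1 + h * S * e) ∘ₗ g) = 0 ∧
    (h * S) ∘ₗ (h * S) = 0 := by
  have hS : S = 1 + S * e * h := by linear_combination (norm := noncomm_ring) hl
  have hS' : h * S = (1 + h * S * e) * h := by
    linear_combination (norm := noncomm_ring) h * hl
  have hSh : S * h = h := by
    linear_combination (norm := noncomm_ring) hS * h + S * e * hh
  have hhSh : h * S * h = 0 := by rw [mul_assoc, hSh, hh]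
  have gf (x : X) : g (f x) = (1 + d * h + h * d) x := by rw [← hgf]; rfl
  have fd (x : X) : f (d x) = 0 := LinearMap.congr_fun hfd x
  have dg (y : Y) : d (g y) = 0 := LinearMap.congr_fun hdg y
  have fg (y : Y) : f (g y) = y := LinearMap.congr_fun hfg y
  have fh (x : X) : f (h x) = 0 := LinearMap.congr_fun hfh x
  have hg (y : Y) : h (g y) = 0 := LinearMap.congr_fun hhg y
  refine ⟨?_, ?_, ?_, ?_, ?_, ?_, ?_, ?_⟩
  · ext y
    have := congrArg f (LinearMap.congr_fun (perturbation_master hd hde hl hr) (g y))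
    simp only [Module.End.mul_apply, LinearMap.add_apply, map_add, dg, fd, map_zero, add_zero,
      LinearMap.zero_apply, Module.End.one_apply] at this
    simp [gf, this]
  · ext x
    have := congrArg f (LinearMap.congr_fun (perturbation_projection_comm hd hde hl hr) x)
    simp only [Module.End.mul_apply, LinearMap.sub_apply, map_sub, fd, sub_zero] at this
    simp only [LinearMap.comp_apply, gf]
    exact this.symm
  · ext y
    have := LinearMap.congr_fun (perturbation_inclusion_comm hd hde hl hr) (g y)
    simp only [Module.End.mul_apply _ _ (g y), LinearMap.sub_apply, dg, map_zero, sub_zero] at this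
    simp only [LinearMap.comp_apply, gf]
    rw [← this]; rfl
  · ext y
    have h1 : S * (1 + h * S * e) = 1 + S * e * h + h * S * e := by
      linear_combination (norm := noncomm_ring) hS + hSh * (S * e)
    have := congrArg f (LinearMap.congr_fun h1 (g y))
    simpa [hg, fh, fg] using this
  · ext x
    have := LinearMap.congr_fun (perturbation_homotopy hd hde hl hr) x
    simp only [LinearMap.comp_apply, gf]
    exact this
  · ext x
    have := congrArg f (LinearMap.congr_fun hSh (S x))
    simpa [fh] using this
  · ext y
    have := LinearMap.congr_fun hhSh ((S * e) (g y))
    have h2 := LinearMap.congr_fun hS' (g y)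
    simp only [Module.End.mul_apply, hg, map_zero] at this h2
    simp [this, h2]
  · change h * S * (h * S) = 0
    rw [← mul_assoc, hhSh, zero_mul]

lemma exists_inverse_one_sub_of_locally_nilpotent (N : Module.End R X)
    (hN : ∀ x, ∃ n : ℕ, (N ^ n) x = 0) :
    ∃ S : Module.End R X, S * (1 - N) = 1 ∧ (1 - N) * S = 1 := by
  have hu : IsUnit (1 - N) := by
    rw [Module.End.isUnit_iff]
    constructor
    · rw [injective_iff_map_eq_zero]
      intro x hx
      have hx' : N x = x := (sub_eq_zero.mp (show x - N x = 0 from hx)).symm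
      obtain ⟨n, hn⟩ := hN x
      have : (N ^ n) x = x := by
        rw [Module.End.pow_apply]
        exact Function.iterate_fixed hx' n
      rw [← this, hn]
    · intro x
      obtain ⟨n, hn⟩ := hN x
      refine ⟨(∑ i ∈ Finset.range n, N ^ i) x, ?_⟩
      rw [← Module.End.mul_apply, mul_neg_geom_sum]
      simp [hn]
  obtain ⟨u, hu⟩ := hu
  exact ⟨(u⁻¹ : (Module.End R X)ˣ), by rw [← hu]; simp, by rw [← hu]; simp⟩

end Contraction

section Paths

variable {ι : Type v} {E : ι → ι → Prop}

/-- The directed paths from `α` to a vertex of degree `n`. -/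
def pathsTo (E : ι → ι → Prop) (deg : ι → ℤ) (α : ι) (n : ℤ) : Set (Σ β, MPath E α β) :=
  {p | deg p.1 = n}

/-- Prolong a path by an initial edge. -/
def consPath {α γ : ι} (e : E α γ) (p : Σ β, MPath E γ β) : Σ β, MPath E α β :=
  ⟨p.1, .cons e p.2⟩

lemma consPath_injective {α γ : ι} (e : E α γ) : Function.Injective (consPath e) := by
  rintro ⟨β, p⟩ ⟨β', p'⟩ h
  simp only [consPath, Sigma.mk.injEq] at h
  obtain ⟨rfl, h⟩ := h
  cases h
  rfl

lemma consPath_disjoint {α γ γ' : ι} (e : E α γ) (e' : E α γ') (hne : γ ≠ γ')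
    (p : Σ β, MPath E γ β) (p' : Σ β, MPath E γ' β) : consPath e p ≠ consPath e' p' := by
  obtain ⟨β, p⟩ := p
  obtain ⟨β', p'⟩ := p'
  intro h
  simp only [consPath, Sigma.mk.injEq] at h
  obtain ⟨rfl, h⟩ := h
  cases h
  exact hne rfl

lemma consPath_ne_nil {α γ : ι} (e : E α γ) (p : Σ β, MPath E γ β) :
    consPath e p ≠ ⟨α, .nil α⟩ := by
  obtain ⟨β, p⟩ := p
  intro h
  simp only [consPath, Sigma.mk.injEq] at h
  obtain ⟨rfl, h⟩ := h
  cases h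

lemma pathsTo_eq (deg : ι → ℤ) (α : ι) (n : ℤ) :
    pathsTo E deg α n = {p | p = ⟨α, .nil α⟩ ∧ deg α = n} ∪
      ⋃ γ : {γ | E α γ}, consPath γ.2 '' pathsTo E deg γ n := by
  ext ⟨β, p⟩
  simp only [pathsTo, Set.mem_ofPred_eq, Set.mem_union, Set.mem_iUnion, Set.mem_image]
  constructor
  · intro h
    cases p with
    | nil => exact Or.inl ⟨rfl, h⟩
    | cons e p => exact Or.inr ⟨⟨_, e⟩, ⟨_, p⟩, h, rfl⟩
  · rintro (⟨h, h'⟩ | ⟨γ, q, h, h'⟩)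
    · cases h
      exact h'
    · rw [← h]
      exact congrArg (fun r => deg r.1) h'.symm

lemma finite_pathsTo_of_forall_edge (deg : ι → ℤ) {α : ι} {n : ℤ} (hfin : {γ | E α γ}.Finite)
    (h : ∀ γ, E α γ → (pathsTo E deg γ n).Finite) : (pathsTo E deg α n).Finite := by
  rw [pathsTo_eq]
  have := hfin.to_subtype
  refine Set.Finite.union ((Set.finite_singleton ⟨α, .nil α⟩).subset fun p hp => hp.1) ?_
  exact Set.finite_iUnion fun γ => (h γ γ.2).image _

end Paths

section MorseLemmas

variable {R : Type u} [Ring R] {ι : Type v}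
  {V : ι → Type w} [∀ α, AddCommGroup (V α)] [∀ α, Module R (V α)]
  {deg : ι → ℤ} {D : ∀ α β, V α →ₗ[R] V β} {M : Set (ι × ι)}

lemma IsMorseMatching.eq_of_mem_of_mem (hM : IsMorseMatching R ι V deg D M) {α β γ δ : ι}
    (h : (α, β) ∈ M) (h' : (γ, δ) ∈ M) (he : α = γ ∨ α = δ ∨ β = γ ∨ β = δ) : α = γ ∧ β = δ :=
  Prod.ext_iff.mp (hM.matching _ h _ h' he)

namespace IsMorseMatching

lemma edgeMap_of_not_mem {α γ : ι} (h : (γ, α) ∉ M) : edgeMap R ι V D M α γ = D α γ :=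
  dif_neg fun h' => h h'.1

lemma apply_edgeMap (hM : IsMorseMatching R ι V deg D M) {α β : ι} (h : (β, α) ∈ M) (x : V α) :
    D β α (edgeMap R ι V D M α β x) = -x := by
  rw [edgeMap, dif_pos ⟨h, hM.iso _ h⟩]
  simp

lemma edgeMap_apply (hM : IsMorseMatching R ι V deg D M) {α β : ι} (h : (β, α) ∈ M) (x : V β) :
    edgeMap R ι V D M α β (D β α x) = -x := by
  rw [edgeMap, dif_pos ⟨h, hM.iso _ h⟩]
  simp

end IsMorseMatching

variable [DecidableEq ι]

lemma toLin_lof {D : ∀ α β, V α →ₗ[R] V β} {α : ι} {s : Finset ι} (hs : ∀ β, D α β ≠ 0 → β ∈ s)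
    (x : V α) :
    toLin R ι V D (DirectSum.lof R ι V α x) = ∑ β ∈ s, DirectSum.lof R ι V β (D α β x) := by
  have hfin : {β | D α β ≠ 0}.Finite := s.finite_toSet.subset hs
  rw [toLin, DirectSum.toModule_lof, dif_pos hfin, LinearMap.sum_apply]
  refine Finset.sum_subset (fun β hβ => hs β (hfin.mem_toFinset.mp hβ)) fun β _ hβ => ?_
  have : D α β = 0 := by simpa using hβ
  simp [this]

namespace IsMorseMatching

lemma deg_of_mem (hM : IsMorseMatching R ι V deg D M) (hC : IsBasedComplex R ι V deg D)
    {α β : ι} (h : (α, β) ∈ M) : deg β = deg α - 1 := by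
  by_contra hne
  exact hM.edge _ h (hC.deg_cond _ _ hne)

lemma not_mem_of_mem (hM : IsMorseMatching R ι V deg D M) (hC : IsBasedComplex R ι V deg D)
    {α β γ : ι} (h : (α, β) ∈ M) : (β, γ) ∉ M := by
  intro h'
  have := hM.eq_of_mem_of_mem h h' (by simp)
  have := hM.deg_of_mem hC h
  grind

lemma finite_morseEdge (hM : IsMorseMatching R ι V deg D M) (hC : IsBasedComplex R ι V deg D)
    (α : ι) : {γ | MorseEdge R ι V D M α γ}.Finite := by
  have hs : {γ | (γ, α) ∈ M}.Subsingleton := fun γ h γ' h' =>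
    (hM.eq_of_mem_of_mem h h' (by simp)).1
  exact ((hC.fin α).union hs.finite).subset fun γ h => h.imp And.left id

lemma deg_le_of_path (hM : IsMorseMatching R ι V deg D M) (hC : IsBasedComplex R ι V deg D)
    {α β : ι} (p : MPath (MorseEdge R ι V D M) α β) :
    deg β ≤ deg α + 1 ∧ ((∃ γ, (α, γ) ∈ M) → deg β ≤ deg α) := by
  induction p with
  | nil => exact ⟨by lia, fun _ => le_rfl⟩
  | @cons α γ β e p ih =>
    obtain ⟨h, -⟩ | h := e
    · have : deg γ = deg α - 1 := not_imp_comm.mp (hC.deg_cond α γ) h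
      exact ⟨by lia, fun _ => by lia⟩
    · have := hM.deg_of_mem hC h
      have := ih.2 ⟨α, h⟩
      exact ⟨by lia, fun ⟨δ, hδ⟩ => absurd hδ (hM.not_mem_of_mem hC h)⟩

lemma finite_pathsTo (hM : IsMorseMatching R ι V deg D M) (hC : IsBasedComplex R ι V deg D)
    (α : ι) (n : ℤ) : (pathsTo (MorseEdge R ι V D M) deg α n).Finite := by
  suffices h : ∀ (m : ℕ) (α : ι), deg α + 2 ≤ n + m →
      (pathsTo (MorseEdge R ι V D M) deg α n).Finite from
    h (deg α + 2 - n).toNat α (by lia)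
  intro m
  induction m with
  | zero =>
    intro α h
    convert Set.finite_empty
    refine Set.eq_empty_of_forall_notMem ?_
    rintro ⟨β, p⟩ (hp : deg β = n)
    have := (hM.deg_le_of_path hC p).1
    simp at h
    lia
  | succ m ihm =>
    obtain ⟨r, hr, -, hedge⟩ := hM.wf
    intro α
    induction α using hr.induction with
    | _ α ih =>
    intro h
    push_cast at h
    refine finite_pathsTo_of_forall_edge deg (hM.finite_morseEdge hC α) fun γ e => ?_
    obtain ⟨h', -⟩ | h' := id e
    · have : deg γ = deg α - 1 := not_imp_comm.mp (hC.deg_cond α γ) h'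
      exact ihm γ (by lia)
    · refine finite_pathsTo_of_forall_edge deg (hM.finite_morseEdge hC γ) fun δ e' => ?_
      have hγ := hM.deg_of_mem hC h'
      have hδ : deg δ = deg α := by
        obtain ⟨h'', -⟩ | h'' := id e'
        · have : deg δ = deg γ - 1 := not_imp_comm.mp (hC.deg_cond γ δ) h''
          lia
        · exact absurd h' (hM.not_mem_of_mem hC h'')
      exact ih δ (hedge α γ δ hδ e e') (by push_cast; lia)

end IsMorseMatching

variable (R ι V) in
/-- The components of the differential along the edges outside the matching. -/
def unmatched (D : ∀ α β, V α →ₗ[R] V β) (M : Set (ι × ι)) (α β : ι) : V α →ₗ[R] V β :=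
  if (α, β) ∈ M then 0 else D α β

variable (R ι V) in
/-- The sum of the maps of all paths of relative degree `k`. -/
def pathSum (deg : ι → ℤ) (D : ∀ α β, V α →ₗ[R] V β) (M : Set (ι × ι)) (k : ℤ) :
    Module.End R (⨁ α, V α) :=
  DirectSum.toModule R ι _ fun α =>
    ∑ᶠ β ∈ {β : ι | deg β = deg α + k}, (DirectSum.lof R ι V β).comp (Gamma R ι V D M α β)

variable (R ι V) in
/-- The sum of the maps of all paths from `α` to vertices of degree `n`. -/
def vertexSum (deg : ι → ℤ) (D : ∀ α β, V α →ₗ[R] V β) (M : Set (ι × ι)) (α : ι) (n : ℤ) :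
    V α →ₗ[R] ⨁ α, V α :=
  ∑ᶠ p ∈ pathsTo (MorseEdge R ι V D M) deg α n,
    (DirectSum.lof R ι V p.1).comp (pathMap R ι V D M p.2)

namespace IsMorseMatching

lemma finite_path (hM : IsMorseMatching R ι V deg D M) (hC : IsBasedComplex R ι V deg D)
    (α β : ι) : Finite (MPath (MorseEdge R ι V D M) α β) :=
  have := (hM.finite_pathsTo hC α (deg β)).to_subtype
  Finite.of_injective (fun p => (⟨⟨β, p⟩, rfl⟩ : pathsTo (MorseEdge R ι V D M) deg α (deg β)))
    fun _ _ h => sigma_mk_injective (Subtype.mk.inj h)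

lemma finite_support_gamma (hM : IsMorseMatching R ι V deg D M)
    (hC : IsBasedComplex R ι V deg D) (α : ι) (n : ℤ) :
    {β | deg β = n ∧ Gamma R ι V D M α β ≠ 0}.Finite := by
  refine ((hM.finite_pathsTo hC α n).image Sigma.fst).subset ?_
  rintro β ⟨hβ, h⟩
  by_contra hp
  have : IsEmpty (MPath (MorseEdge R ι V D M) α β) := ⟨fun p => hp ⟨⟨β, p⟩, hβ, rfl⟩⟩
  exact h (finsum_of_isEmpty _)

lemma vertexSum_eq (hM : IsMorseMatching R ι V deg D M) (hC : IsBasedComplex R ι V deg D)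
    (α : ι) (n : ℤ) : vertexSum R ι V deg D M α n =
      ∑ᶠ β ∈ {β : ι | deg β = n}, (DirectSum.lof R ι V β).comp (Gamma R ι V D M α β) := by
  have hfin := hM.finite_pathsTo hC α n
  set s := (hfin.image Sigma.fst).toFinset with hs
  have h1 : pathsTo (MorseEdge R ι V D M) deg α n =
      ⋃ β ∈ s, Set.range (fun p : MPath (MorseEdge R ι V D M) α β => (⟨β, p⟩ : Σ β, _)) := by
    ext ⟨β, p⟩
    simp only [hs, Set.Finite.mem_toFinset, Set.mem_image, Set.mem_iUnion, Set.mem_range]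
    constructor
    · exact fun h => ⟨β, ⟨_, h, rfl⟩, p, rfl⟩
    · rintro ⟨β', ⟨q, hq, rfl⟩, p', h⟩
      cases h
      exact hq
  rw [vertexSum, h1, ← Finset.set_biUnion_coe, finsum_mem_biUnion]
  · rw [finsum_mem_coe_finset]
    have h2 (β : ι) : ∑ᶠ p ∈ Set.range
        (fun p : MPath (MorseEdge R ι V D M) α β => (⟨β, p⟩ : Σ β, _)),
          (DirectSum.lof R ι V p.1).comp (pathMap R ι V D M p.2) =
        (DirectSum.lof R ι V β).comp (Gamma R ι V D M α β) := by
      have := hM.finite_path hC α β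
      rw [finsum_mem_range sigma_mk_injective, Gamma]
      exact ((LinearMap.compRight ℤ (DirectSum.lof R ι V β)).toAddMonoidHom.map_finsum
        (Set.toFinite _)).symm
    rw [Finset.sum_congr rfl fun β _ => h2 β]
    refine (finsum_mem_eq_sum_of_subset _ ?_ ?_).symm
    · rintro β ⟨hβ, h⟩
      by_contra hp
      have : IsEmpty (MPath (MorseEdge R ι V D M) α β) :=
        ⟨fun p => hp ((Set.Finite.mem_toFinset _).mpr ⟨⟨β, p⟩, hβ, rfl⟩)⟩
      have h0 : Gamma R ι V D M α β = 0 := finsum_of_isEmpty _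
      exact h (by simp [h0])
    · intro β hβ
      obtain ⟨p, hp, rfl⟩ := (Set.Finite.mem_toFinset _).mp hβ
      exact hp
  · intro β _ β' _ hne
    refine Set.disjoint_left.mpr ?_
    rintro _ ⟨p, rfl⟩ ⟨p', h⟩
    exact hne (congrArg Sigma.fst h).symm
  · exact s.finite_toSet
  · intro β _
    have := hM.finite_path hC α β
    exact Set.finite_range _

lemma vertexSum_rec (hM : IsMorseMatching R ι V deg D M) (hC : IsBasedComplex R ι V deg D)
    (α : ι) (n : ℤ) : vertexSum R ι V deg D M α n =
      (if deg α = n then DirectSum.lof R ι V α else 0) +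
      ∑ γ ∈ (hM.finite_morseEdge hC α).toFinset,
        (vertexSum R ι V deg D M γ n).comp (edgeMap R ι V D M α γ) := by
  have := (hM.finite_morseEdge hC α).to_subtype
  rw [vertexSum, pathsTo_eq, finsum_mem_union]
  · congr 1
    · split_ifs with h
      · simp [h, pathMap]
      · simp [h]
    · rw [finsum_mem_iUnion]
      · rw [← finsum_mem_eq_finite_toFinset_sum, ← finsum_set_coe_eq_finsum_mem]
        refine finsum_congr fun γ => ?_
        rw [finsum_mem_image (consPath_injective _).injOn]
        exact ((LinearMap.lcomp ℤ (⨁ α, V α) (edgeMap R ι V D M α γ)).toAddMonoidHom.map_finsum_mem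
          (fun p => (DirectSum.lof R ι V p.1).comp (pathMap R ι V D M p.2))
          (hM.finite_pathsTo hC γ n)).symm
      · intro γ γ' hne
        refine Set.disjoint_left.mpr ?_
        rintro _ ⟨p, -, rfl⟩ ⟨p', -, h⟩
        exact consPath_disjoint (E := MorseEdge R ι V D M) γ.2 γ'.2
          (Subtype.coe_injective.ne hne) p p' h.symm
      · exact fun γ => (hM.finite_pathsTo hC γ n).image _
  · refine Set.disjoint_left.mpr ?_
    rintro _ ⟨rfl, -⟩ h
    obtain ⟨γ, q, -, h⟩ := Set.mem_iUnion.mp h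
    exact consPath_ne_nil _ _ h
  · exact (Set.finite_singleton ⟨α, .nil α⟩).subset fun p hp => hp.1
  · exact Set.finite_iUnion fun γ => (hM.finite_pathsTo hC γ n).image _

lemma hTilde_lof (hM : IsMorseMatching R ι V deg D M) {α β : ι} (h : (β, α) ∈ M) (x : V α) :
    hTilde R ι V D M (DirectSum.lof R ι V α x) =
      DirectSum.lof R ι V β (edgeMap R ι V D M α β x) := by
  have hex : ∃ β, (β, α) ∈ M ∧ Function.Bijective (D β α) := ⟨β, h, hM.iso _ h⟩
  obtain rfl : β = hex.choose := (hM.eq_of_mem_of_mem h hex.choose_spec.1 (by simp)).1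
  rw [hTilde, DirectSum.toModule_lof, dif_pos hex, edgeMap, dif_pos hex.choose_spec]
  simp

lemma hTilde_lof_of_forall_not_mem {α : ι} (h : ∀ β, (β, α) ∉ M) (x : V α) :
    hTilde R ι V D M (DirectSum.lof R ι V α x) = 0 := by
  rw [hTilde, DirectSum.toModule_lof, dif_neg fun ⟨β, hβ, _⟩ => h β hβ, LinearMap.zero_apply]

lemma dTilde_lof (hM : IsMorseMatching R ι V deg D M) {α β : ι} (h : (α, β) ∈ M) (x : V α) :
    dTilde R ι V D M (DirectSum.lof R ι V α x) = DirectSum.lof R ι V β (D α β x) := by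
  rw [dTilde, toLin_lof (s := {β})]
  · simp [h]
  · intro γ hγ
    have : (α, γ) ∈ M := by
      by_contra h'
      simp [h'] at hγ
    simpa using (hM.eq_of_mem_of_mem this h (by simp)).2

lemma dTilde_lof_of_forall_not_mem {α : ι} (h : ∀ β, (α, β) ∉ M) (x : V α) :
    dTilde R ι V D M (DirectSum.lof R ι V α x) = 0 := by
  rw [dTilde, toLin_lof (s := ∅)]
  · simp
  · intro γ hγ
    simp [h] at hγ

lemma toLin_eq_add (hC : IsBasedComplex R ι V deg D) :
    toLin R ι V D = dTilde R ι V D M + toLin R ι V (unmatched R ι V D M) := by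
  refine DirectSum.linearMap_ext _ fun α => LinearMap.ext fun x => ?_
  have hs (β : ι) (h : D α β ≠ 0) : β ∈ (hC.fin α).toFinset := by simpa using h
  rw [LinearMap.comp_apply, LinearMap.comp_apply, LinearMap.add_apply, dTilde, toLin_lof hs,
    toLin_lof (s := (hC.fin α).toFinset), toLin_lof (s := (hC.fin α).toFinset),
    ← Finset.sum_add_distrib]
  · refine Finset.sum_congr rfl fun β _ => ?_
    by_cases h : (α, β) ∈ M <;> simp [h, unmatched]
  · intro β h
    refine hs β fun h0 => h ?_
    simp [h0, unmatched]
  · intro β h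
    refine hs β fun h0 => h ?_
    simp [h0]

lemma hTilde_lof_eq_sum (hM : IsMorseMatching R ι V deg D M) (hC : IsBasedComplex R ι V deg D)
    (α : ι) (x : V α) : hTilde R ι V D M (DirectSum.lof R ι V α x) =
      ∑ γ ∈ (hM.finite_morseEdge hC α).toFinset,
        if (γ, α) ∈ M then DirectSum.lof R ι V γ (edgeMap R ι V D M α γ x) else 0 := by
  by_cases h : ∃ β, (β, α) ∈ M
  · obtain ⟨β, h⟩ := h
    rw [hM.hTilde_lof h, Finset.sum_eq_single β, if_pos h]
    · intro γ _ hne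
      exact if_neg fun h' => hne (hM.eq_of_mem_of_mem h' h (by simp)).1
    · intro hβ
      exact absurd ((hM.finite_morseEdge hC α).mem_toFinset.mpr (Or.inr h)) hβ
  · push Not at h
    rw [hTilde_lof_of_forall_not_mem h]
    simp [h]

lemma toLin_unmatched_lof (hM : IsMorseMatching R ι V deg D M) (hC : IsBasedComplex R ι V deg D)
    (α : ι) (x : V α) : toLin R ι V (unmatched R ι V D M) (DirectSum.lof R ι V α x) =
      ∑ γ ∈ (hM.finite_morseEdge hC α).toFinset,
        DirectSum.lof R ι V γ (unmatched R ι V D M α γ x) := by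
  refine toLin_lof (fun γ h => (Set.Finite.mem_toFinset _).mpr (Or.inl ?_)) x
  by_cases h' : (α, γ) ∈ M
  · simp [unmatched, h'] at h
  · exact ⟨by simpa [unmatched, h'] using h, h'⟩

lemma pathSum_lof (hM : IsMorseMatching R ι V deg D M) (hC : IsBasedComplex R ι V deg D)
    (k : ℤ) (α : ι) (x : V α) : pathSum R ι V deg D M k (DirectSum.lof R ι V α x) =
      vertexSum R ι V deg D M α (deg α + k) x := by
  rw [hM.vertexSum_eq hC, pathSum, DirectSum.toModule_lof]

lemma pathSum_eq (hM : IsMorseMatching R ι V deg D M) (hC : IsBasedComplex R ι V deg D) (k : ℤ) :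
    pathSum R ι V deg D M k = (if k = 0 then 1 else 0) +
      pathSum R ι V deg D M (k + 1) * toLin R ι V (unmatched R ι V D M) +
      pathSum R ι V deg D M (k - 1) * hTilde R ι V D M := by
  refine DirectSum.linearMap_ext _ fun α => LinearMap.ext fun x => ?_
  simp only [LinearMap.comp_apply, LinearMap.add_apply, Module.End.mul_apply]
  rw [hM.pathSum_lof hC, hM.vertexSum_rec hC, LinearMap.add_apply, add_assoc,
    hM.toLin_unmatched_lof hC, hM.hTilde_lof_eq_sum hC, map_sum, map_sum,
    ← Finset.sum_add_distrib, LinearMap.sum_apply]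
  congr 1
  · by_cases hk : k = 0 <;> simp [hk]
  · refine Finset.sum_congr rfl fun γ hγ => ?_
    rw [LinearMap.comp_apply, hM.pathSum_lof hC]
    by_cases h : (γ, α) ∈ M
    · have hdeg := hM.deg_of_mem hC h
      have h0 : unmatched R ι V D M α γ = 0 := by
        rw [unmatched, if_neg (hM.not_mem_of_mem hC h), hC.deg_cond]
        lia
      rw [if_pos h, hM.pathSum_lof hC, h0, LinearMap.zero_apply, map_zero, zero_add,
        show deg γ + (k - 1) = deg α + k by lia]
    · obtain ⟨hD, hm⟩ := ((Set.Finite.mem_toFinset _).mp hγ).resolve_right h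
      have : deg γ = deg α - 1 := not_imp_comm.mp (hC.deg_cond α γ) hD
      rw [if_neg h, map_zero, add_zero, edgeMap_of_not_mem h, unmatched, if_neg hm,
        show deg γ + (k + 1) = deg α + k by lia]

lemma pathSum_two (hM : IsMorseMatching R ι V deg D M) (hC : IsBasedComplex R ι V deg D) :
    pathSum R ι V deg D M 2 = 0 := by
  refine DirectSum.linearMap_ext _ fun α => LinearMap.ext fun x => ?_
  have : pathsTo (MorseEdge R ι V D M) deg α (deg α + 2) = ∅ := by
    refine Set.eq_empty_of_forall_notMem ?_
    rintro ⟨β, p⟩ (hp : deg β = deg α + 2)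
    have := (hM.deg_le_of_path hC p).1
    lia
  rw [LinearMap.comp_apply, hM.pathSum_lof hC, vertexSum, this]
  simp

lemma locally_nilpotent (hM : IsMorseMatching R ι V deg D M) (hC : IsBasedComplex R ι V deg D)
    (x : ⨁ α, V α) :
    ∃ n : ℕ, ((toLin R ι V (unmatched R ι V D M) * hTilde R ι V D M) ^ n) x = 0 := by
  set N := toLin R ι V (unmatched R ι V D M) * hTilde R ι V D M with hN
  let K : Submodule R (⨁ α, V α) := ⨆ n, N.iterateKer n
  have hmem (y : ⨁ α, V α) : y ∈ K ↔ ∃ n : ℕ, (N ^ n) y = 0 :=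
    Submodule.mem_iSup_of_chain N.iterateKer y
  have hstep (y : ⨁ α, V α) (h : N y ∈ K) : y ∈ K := by
    obtain ⟨n, hn⟩ := (hmem _).mp h
    exact (hmem y).mpr ⟨n + 1, by rwa [pow_succ, Module.End.mul_apply]⟩
  rw [← hmem]
  obtain ⟨r, hr, -, hedge⟩ := hM.wf
  have hlof (α : ι) : ∀ y : V α, DirectSum.lof R ι V α y ∈ K := by
    induction α using hr.induction with
    | _ α ih =>
    intro y
    refine hstep _ ?_
    by_cases h : ∃ β, (β, α) ∈ M
    · obtain ⟨β, h⟩ := h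
      rw [hN, Module.End.mul_apply, hM.hTilde_lof h, hM.toLin_unmatched_lof hC]
      refine Submodule.sum_mem _ fun γ _ => ?_
      by_cases h0 : unmatched R ι V D M β γ = 0
      · simp [h0]
      · have hm : (β, γ) ∉ M := fun hm => h0 (if_pos hm)
        have hD : D β γ ≠ 0 := by rwa [unmatched, if_neg hm] at h0
        have h1 := hM.deg_of_mem hC h
        have h2 : deg γ = deg β - 1 := not_imp_comm.mp (hC.deg_cond β γ) hD
        exact ih γ (hedge α β γ (by lia) (Or.inr h) (Or.inl ⟨hD, hm⟩)) _
    · push Not at h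
      rw [hN, Module.End.mul_apply, hTilde_lof_of_forall_not_mem h, map_zero]
      exact Submodule.zero_mem _
  induction x using DirectSum.induction_on with
  | zero => exact Submodule.zero_mem _
  | of α y => exact hlof α y
  | add y z hy hz => exact Submodule.add_mem _ hy hz

lemma fTilde_lof_of_not_mem {α : ι} (h : α ∉ MZero M) (x : V α) :
    fTilde R ι V M (DirectSum.lof R ι V α x) = 0 := by
  rw [fTilde, DirectSum.toModule_lof, dif_neg h, LinearMap.zero_apply]

lemma fTilde_lof (u : MZero M) (x : V u) :
    fTilde R ι V M (DirectSum.lof R ι V u x) =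
      DirectSum.lof R (MZero M) (fun s => V s.1) u x := by
  rw [fTilde, DirectSum.toModule_lof, dif_pos u.2]

lemma gTilde_lof (u : MZero M) (x : V u) :
    gTilde R ι V M (DirectSum.lof R (MZero M) (fun s => V s.1) u x) =
      DirectSum.lof R ι V u x := by
  rw [gTilde, DirectSum.toModule_lof]

lemma dTilde_mul_dTilde (hM : IsMorseMatching R ι V deg D M) (hC : IsBasedComplex R ι V deg D) :
    dTilde R ι V D M * dTilde R ι V D M = 0 := by
  refine DirectSum.linearMap_ext _ fun α => LinearMap.ext fun x => ?_
  rw [LinearMap.comp_apply, Module.End.mul_apply]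
  by_cases h : ∃ β, (α, β) ∈ M
  · obtain ⟨β, h⟩ := h
    rw [hM.dTilde_lof h, dTilde_lof_of_forall_not_mem fun γ => hM.not_mem_of_mem hC h]
    rfl
  · push Not at h
    rw [dTilde_lof_of_forall_not_mem h, map_zero]
    rfl

lemma hTilde_mul_hTilde (hM : IsMorseMatching R ι V deg D M) (hC : IsBasedComplex R ι V deg D) :
    hTilde R ι V D M * hTilde R ι V D M = 0 := by
  refine DirectSum.linearMap_ext _ fun α => LinearMap.ext fun x => ?_
  rw [LinearMap.comp_apply, Module.End.mul_apply]
  by_cases h : ∃ β, (β, α) ∈ M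
  · obtain ⟨β, h⟩ := h
    rw [hM.hTilde_lof h, hTilde_lof_of_forall_not_mem fun γ h' => hM.not_mem_of_mem hC h' h]
    rfl
  · push Not at h
    rw [hTilde_lof_of_forall_not_mem h, map_zero]
    rfl

lemma fTilde_comp_dTilde (hM : IsMorseMatching R ι V deg D M) :
    fTilde R ι V M ∘ₗ dTilde R ι V D M = 0 := by
  refine DirectSum.linearMap_ext _ fun α => LinearMap.ext fun x => ?_
  rw [LinearMap.comp_apply, LinearMap.comp_apply]
  by_cases h : ∃ β, (α, β) ∈ M
  · obtain ⟨β, h⟩ := h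
    rw [hM.dTilde_lof h, fTilde_lof_of_not_mem fun h' => (h' α).2 h]
    rfl
  · push Not at h
    rw [dTilde_lof_of_forall_not_mem h, map_zero]
    rfl

lemma fTilde_comp_hTilde (hM : IsMorseMatching R ι V deg D M) :
    fTilde R ι V M ∘ₗ hTilde R ι V D M = 0 := by
  refine DirectSum.linearMap_ext _ fun α => LinearMap.ext fun x => ?_
  rw [LinearMap.comp_apply, LinearMap.comp_apply]
  by_cases h : ∃ β, (β, α) ∈ M
  · obtain ⟨β, h⟩ := h
    rw [hM.hTilde_lof h, fTilde_lof_of_not_mem fun h' => (h' α).1 h]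
    rfl
  · push Not at h
    rw [hTilde_lof_of_forall_not_mem h, map_zero]
    rfl

lemma dTilde_comp_gTilde : dTilde R ι V D M ∘ₗ gTilde R ι V M = 0 := by
  refine DirectSum.linearMap_ext _ fun u => LinearMap.ext fun x => ?_
  rw [LinearMap.comp_apply, LinearMap.comp_apply, gTilde_lof,
    dTilde_lof_of_forall_not_mem fun β => (u.2 β).1]
  rfl

lemma hTilde_comp_gTilde : hTilde R ι V D M ∘ₗ gTilde R ι V M = 0 := by
  refine DirectSum.linearMap_ext _ fun u => LinearMap.ext fun x => ?_
  rw [LinearMap.comp_apply, LinearMap.comp_apply, gTilde_lof,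
    hTilde_lof_of_forall_not_mem fun β => (u.2 β).2]
  rfl

lemma fTilde_comp_gTilde : fTilde R ι V M ∘ₗ gTilde R ι V M = LinearMap.id := by
  refine DirectSum.linearMap_ext _ fun u => LinearMap.ext fun x => ?_
  rw [LinearMap.comp_apply, LinearMap.comp_apply, gTilde_lof, fTilde_lof]
  rfl

lemma gTilde_comp_fTilde (hM : IsMorseMatching R ι V deg D M)
    (hC : IsBasedComplex R ι V deg D) : gTilde R ι V M ∘ₗ fTilde R ι V M =
      1 + dTilde R ι V D M * hTilde R ι V D M + hTilde R ι V D M * dTilde R ι V D M := by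
  refine DirectSum.linearMap_ext _ fun α => LinearMap.ext fun x => ?_
  simp only [LinearMap.comp_apply, LinearMap.add_apply, Module.End.mul_apply,
    Module.End.one_apply]
  by_cases h : ∃ β, (α, β) ∈ M
  · obtain ⟨β, h⟩ := h
    rw [fTilde_lof_of_not_mem fun h' => (h' β).1 h, hM.dTilde_lof h, hM.hTilde_lof h,
      hM.edgeMap_apply h, hTilde_lof_of_forall_not_mem fun γ h' => hM.not_mem_of_mem hC h' h]
    simp
  · by_cases h' : ∃ β, (β, α) ∈ M
    · obtain ⟨β, h'⟩ := h'
      push Not at h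
      rw [fTilde_lof_of_not_mem fun h => (h β).2 h', hM.hTilde_lof h', hM.dTilde_lof h',
        hM.apply_edgeMap h', dTilde_lof_of_forall_not_mem h]
      simp
    · push Not at h h'
      rw [fTilde_lof ⟨α, fun β => ⟨h β, h' β⟩⟩, gTilde_lof, dTilde_lof_of_forall_not_mem h,
        hTilde_lof_of_forall_not_mem h']
      simp

lemma fTilde_vertexSum (hM : IsMorseMatching R ι V deg D M) (hC : IsBasedComplex R ι V deg D)
    (α : ι) (n : ℤ) : fTilde R ι V M ∘ₗ vertexSum R ι V deg D M α n =
      ∑ᶠ u ∈ {u : MZero M | deg u.1 = n},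
        (DirectSum.lof R (MZero M) (fun v : MZero M => V v.1) u).comp
          (Gamma R ι V D M α u.1) := by
  set F : ι → V α →ₗ[R] ⨁ s : MZero M, V s.1 := fun β =>
    fTilde R ι V M ∘ₗ DirectSum.lof R ι V β ∘ₗ Gamma R ι V D M α β with hF
  have h1 : fTilde R ι V M ∘ₗ vertexSum R ι V deg D M α n =
      ∑ᶠ β ∈ {β : ι | deg β = n}, F β := by
    rw [hM.vertexSum_eq hC]
    refine (LinearMap.compRight ℤ (fTilde R ι V M)).toAddMonoidHom.map_finsum_mem' ?_
    refine (hM.finite_support_gamma hC α n).subset fun β hβ => ⟨hβ.1, fun h0 => hβ.2 ?_⟩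
    simp [h0]
  have h2 (u : MZero M) : (DirectSum.lof R (MZero M) (fun v : MZero M => V v.1) u).comp
      (Gamma R ι V D M α u.1) = F u := by
    ext1 x
    exact (fTilde_lof u _).symm
  simp_rw [h1, h2]
  rw [← finsum_mem_image (f := F) (g := Subtype.val) Subtype.coe_injective.injOn]
  refine finsum_mem_inter_support_eq' _ _ _ fun β hβ => ⟨fun h => ?_, ?_⟩
  · refine ⟨⟨β, ?_⟩, h, rfl⟩
    by_contra hβ'
    refine hβ (LinearMap.ext fun x => ?_)
    exact fTilde_lof_of_not_mem hβ' _
  · rintro ⟨u, hu, rfl⟩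
    exact hu

lemma fMorse_eq (hM : IsMorseMatching R ι V deg D M) (hC : IsBasedComplex R ι V deg D) :
    fMorse R ι V deg D M = fTilde R ι V M ∘ₗ pathSum R ι V deg D M 0 := by
  refine DirectSum.linearMap_ext _ fun α => LinearMap.ext fun x => ?_
  rw [LinearMap.comp_apply, LinearMap.comp_apply, LinearMap.comp_apply, hM.pathSum_lof hC,
    add_zero, ← LinearMap.comp_apply (fTilde R ι V M), hM.fTilde_vertexSum hC, fMorse,
    DirectSum.toModule_lof]

lemma gMorse_eq : gMorse R ι V deg D M = pathSum R ι V deg D M 0 ∘ₗ gTilde R ι V M := by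
  refine DirectSum.linearMap_ext _ fun u => LinearMap.ext fun x => ?_
  simp only [LinearMap.comp_apply, gTilde_lof]
  rw [gMorse, pathSum, DirectSum.toModule_lof, DirectSum.toModule_lof, add_zero]

lemma dMorse_eq (hM : IsMorseMatching R ι V deg D M) (hC : IsBasedComplex R ι V deg D) :
    dMorse R ι V deg D M =
      fTilde R ι V M ∘ₗ pathSum R ι V deg D M (-1) ∘ₗ gTilde R ι V M := by
  refine DirectSum.linearMap_ext _ fun u => LinearMap.ext fun x => ?_
  simp only [LinearMap.comp_apply, gTilde_lof]
  rw [hM.pathSum_lof hC, ← LinearMap.comp_apply (fTilde R ι V M), hM.fTilde_vertexSum hC, dMorse,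
    DirectSum.toModule_lof, sub_eq_add_neg]

lemma hMorse_eq : hMorse R ι V deg D M = pathSum R ι V deg D M 1 := rfl

end IsMorseMatching
end MorseLemmas

theorem morse_main_lemma
    (R : Type u) [Ring R] (ι : Type v) [DecidableEq ι]
    (V : ι → Type w) [∀ α, AddCommGroup (V α)] [∀ α, Module R (V α)]
    (deg : ι → ℤ) (D : ∀ α β, V α →ₗ[R] V β) (M : Set (ι × ι))
    (hC : IsBasedComplex R ι V deg D) (hM : IsMorseMatching R ι V deg D M) :
    -- `C^M` is a complex
    dMorse R ι V deg D M ∘ₗ dMorse R ι V deg D M = 0 ∧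
    -- `f` and `g` are chain maps
    fMorse R ι V deg D M ∘ₗ toLin R ι V D =
      dMorse R ι V deg D M ∘ₗ fMorse R ι V deg D M ∧
    toLin R ι V D ∘ₗ gMorse R ι V deg D M =
      gMorse R ι V deg D M ∘ₗ dMorse R ι V deg D M ∧
    -- the contraction identities
    fMorse R ι V deg D M ∘ₗ gMorse R ι V deg D M = LinearMap.id ∧
    gMorse R ι V deg D M ∘ₗ fMorse R ι V deg D M =
      LinearMap.id + toLin R ι V D ∘ₗ hMorse R ι V deg D M
        + hMorse R ι V deg D M ∘ₗ toLin R ι V D ∧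
    fMorse R ι V deg D M ∘ₗ hMorse R ι V deg D M = 0 ∧
    hMorse R ι V deg D M ∘ₗ gMorse R ι V deg D M = 0 ∧
    hMorse R ι V deg D M ∘ₗ hMorse R ι V deg D M = 0 := by
  obtain ⟨S, hl, hr⟩ := exists_inverse_one_sub_of_locally_nilpotent _ (hM.locally_nilpotent hC)
  set d := dTilde R ι V D M
  set e := toLin R ι V (unmatched R ι V D M)
  set h := hTilde R ι V D M
  have hd : d * d = 0 := hM.dTilde_mul_dTilde hC
  have hh : h * h = 0 := hM.hTilde_mul_hTilde hC
  have hD : toLin R ι V D = d + e := IsMorseMatching.toLin_eq_add hC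
  have hde : (d + e) * (d + e) = 0 := hD ▸ hC.dsq
  have hfh := hM.fTilde_comp_hTilde
  have hhg := IsMorseMatching.hTilde_comp_gTilde (R := R) (V := V) (D := D) (M := M)
  have p1 := hM.pathSum_eq hC 1
  have p0 := hM.pathSum_eq hC 0
  have pm := hM.pathSum_eq hC (-1)
  norm_num only [hM.pathSum_two hC, if_true, if_false, zero_mul, zero_add] at p1 p0 pm
  obtain ⟨hP₁, hP₀⟩ := eq_of_graded_recursion hh hr p1 p0 pm
  have hf : fMorse R ι V deg D M = fTilde R ι V M ∘ₗ S := by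
    rw [hM.fMorse_eq hC, hP₀, LinearMap.comp_add, Module.End.mul_eq_comp h,
      ← LinearMap.comp_assoc, hfh, LinearMap.zero_comp, add_zero]
  have hg : gMorse R ι V deg D M = (1 + h * S * e) ∘ₗ gTilde R ι V M := by
    rw [IsMorseMatching.gMorse_eq, p0, hP₁, LinearMap.add_comp,
      Module.End.mul_eq_comp _ h, LinearMap.comp_assoc, hhg, LinearMap.comp_zero, add_zero]
  have hdM : dMorse R ι V deg D M = fTilde R ι V M ∘ₗ S ∘ₗ e ∘ₗ gTilde R ι V M := by
    rw [hM.dMorse_eq hC, pm, LinearMap.add_comp, Module.End.mul_eq_comp _ h,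
      LinearMap.comp_assoc _ h, hhg, LinearMap.comp_zero, add_zero, Module.End.mul_eq_comp,
      LinearMap.comp_assoc, ← LinearMap.comp_assoc _ _ (fTilde R ι V M), ← hM.fMorse_eq hC, hf,
      LinearMap.comp_assoc]
  have hhM : hMorse R ι V deg D M = h * S := IsMorseMatching.hMorse_eq.trans hP₁
  rw [hD, hf, hg, hdM, hhM]
  exact contraction_of_perturbation hd hde hM.fTilde_comp_dTilde
    IsMorseMatching.dTilde_comp_gTilde IsMorseMatching.fTilde_comp_gTilde
    (hM.gTilde_comp_fTilde hC) hfh hhg hh hl hr
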